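/- Maximal entanglement is monotone under local quantum operations: if σ_{A'B'} = (Φ ⊗ Ψ)(ρ_AB) where Φ and Ψ are completely positive trace-preserving maps acting on the A and B systems respectively (each given by Kraus operators summing to the identity), then μ_ent(ρ_AB) ≥ μ_ent(σ_{A'B'}). -/

import Mathlib

open scoped Matrix Kronecker ComplexOrder
open Matrix

noncomputable section

/-- Partial trace over the second (B) system. -/
def ptrB {A B : Type*} [Fintype B] (ρ : Matrix (A × B) (A × B) ℂ) : Matrix A A ℂ :=
  fun i j => ∑ k, ρ (i, k) (j, k)

/-- Partial trace over the first (A) system. -/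
def ptrA {A B : Type*} [Fintype A] (ρ : Matrix (A × B) (A × B) ℂ) : Matrix B B ℂ :=
  fun k l => ∑ i, ρ (i, k) (i, l)

/-- A density matrix: positive semidefinite with trace one. -/
def IsDensity {n : Type*} [Fintype n] (ρ : Matrix n n ℂ) : Prop :=
  ρ.PosSemidef ∧ ρ.trace = 1

/-- Maximal correlation of a bipartite state. -/
def mu {A B : Type*} [Fintype A] [Fintype B] (ρ : Matrix (A × B) (A × B) ℂ) : ℝ :=
  sSup {r : ℝ | ∃ (X : Matrix A A ℂ) (Y : Matrix B B ℂ),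
    ((ptrB ρ) * X).trace = 0 ∧ ((ptrA ρ) * Y).trace = 0 ∧
    ((ptrB ρ) * (X * Xᴴ)).trace = 1 ∧ ((ptrA ρ) * (Y * Yᴴ)).trace = 1 ∧
    r = ‖(ρ * (X ⊗ₖ Yᴴ)).trace‖}

/-- Maximal entanglement: infimum over finite decompositions of the max correlation. -/
def muEnt {A B : Type*} [Fintype A] [Fintype B] (ρ : Matrix (A × B) (A × B) ℂ) : ℝ :=
  sInf {r : ℝ | ∃ (m : ℕ) (p : Fin m → ℝ) (τ : Fin m → Matrix (A × B) (A × B) ℂ),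
    (∀ i, 0 ≤ p i) ∧ (∑ i, p i) = 1 ∧ (∀ i, IsDensity (τ i)) ∧
    ρ = ∑ i, p i • τ i ∧ r = ⨆ i, mu (τ i)}

/-- Application of a product channel given by local Kraus operators. -/
def applyLocal {A B A' B' ι κ : Type*} [Fintype A] [Fintype B] [Fintype ι] [Fintype κ]
    (K : ι → Matrix A' A ℂ) (L : κ → Matrix B' B ℂ)
    (ρ : Matrix (A × B) (A × B) ℂ) : Matrix (A' × B') (A' × B') ℂ :=
  ∑ k, ∑ m, (K k ⊗ₖ L m) * ρ * (K k ⊗ₖ L m)ᴴ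

/-- Tensor product of two bipartite states, with the A-systems grouped together. -/
def prodState {A B A' B' : Type*}
    (ρ : Matrix (A × B) (A × B) ℂ) (σ : Matrix (A' × B') (A' × B') ℂ) :
    Matrix ((A × A') × (B × B')) ((A × A') × (B × B')) ℂ :=
  fun x y => ρ (x.1.1, x.2.1) (y.1.1, y.2.1) * σ (x.1.2, x.2.2) (y.1.2, y.2.2)

/-- n-fold tensor power of a bipartite state, with all A-systems grouped together. -/
def powState {A B : Type*} (ρ : Matrix (A × B) (A × B) ℂ) (n : ℕ) :
    Matrix ((Fin n → A) × (Fin n → B)) ((Fin n → A) × (Fin n → B)) ℂ :=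
  fun x y => ∏ i, ρ (x.1 i, x.2 i) (y.1 i, y.2 i)

/-- The two-qubit Bell vector (|00⟩+|11⟩)/√2. -/
def bellVec : Fin 2 × Fin 2 → ℂ := fun p => if p.1 = p.2 then 1 / (Real.sqrt 2 : ℂ) else 0

/-- Inverse of the positive semidefinite square root. -/
def invSqrt {n : Type*} [Fintype n] [DecidableEq n] (M : Matrix n n ℂ) : Matrix n n ℂ :=
  letI := Classical.dec M.PosSemidef
  if h : M.PosSemidef then
    (h.1.eigenvectorUnitary.1 * diagonal (((↑) : ℝ → ℂ) ∘ Real.sqrt ∘ h.1.eigenvalues) *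
      (star h.1.eigenvectorUnitary : Matrix n n ℂ))⁻¹
  else 0

lemma trace_ptrB_mul {A B : Type*} [Fintype A] [Fintype B] [DecidableEq B]
    (ρ : Matrix (A × B) (A × B) ℂ) (X : Matrix A A ℂ) :
    (ptrB ρ * X).trace = (ρ * (X ⊗ₖ (1 : Matrix B B ℂ))).trace := by
  simp only [Matrix.trace, Matrix.diag, Matrix.mul_apply, ptrB, kroneckerMap_apply,
    Fintype.sum_prod_type, Finset.sum_mul, Matrix.one_apply, mul_ite, mul_one, mul_zero,
    Finset.sum_ite_eq', Finset.mem_univ, if_true]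
  exact Finset.sum_congr rfl fun i _ => Finset.sum_comm

lemma trace_ptrA_mul {A B : Type*} [Fintype A] [Fintype B] [DecidableEq A]
    (ρ : Matrix (A × B) (A × B) ℂ) (Y : Matrix B B ℂ) :
    (ptrA ρ * Y).trace = (ρ * ((1 : Matrix A A ℂ) ⊗ₖ Y)).trace := by
  simp only [Matrix.trace, Matrix.diag, Matrix.mul_apply, ptrA, kroneckerMap_apply,
    Fintype.sum_prod_type_right, Finset.sum_mul, Matrix.one_apply, mul_ite, ite_mul, one_mul,
    mul_zero, zero_mul, Finset.sum_ite_eq', Finset.mem_univ, if_true]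
  exact Finset.sum_congr rfl fun i _ => Finset.sum_comm

/-- The Heisenberg-picture (adjoint) map of the channel with Kraus operators `K`. -/
def krausAdjoint {A A' ι : Type*} [Fintype A'] [Fintype ι]
    (K : ι → Matrix A' A ℂ) (X : Matrix A' A' ℂ) : Matrix A A ℂ :=
  ∑ k, (K k)ᴴ * X * K k

lemma krausAdjoint_one {A A' ι : Type*} [DecidableEq A] [Fintype A'] [DecidableEq A'] [Fintype ι]
    {K : ι → Matrix A' A ℂ} (hK : ∑ k, (K k)ᴴ * K k = 1) : krausAdjoint K 1 = 1 := by
  simpa [krausAdjoint] using hK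

lemma krausAdjoint_conjTranspose {A A' ι : Type*} [Fintype A'] [Fintype ι]
    (K : ι → Matrix A' A ℂ) (X : Matrix A' A' ℂ) :
    krausAdjoint K Xᴴ = (krausAdjoint K X)ᴴ := by
  simp [krausAdjoint, conjTranspose_sum, conjTranspose_mul, Matrix.mul_assoc]

lemma trace_applyLocal_mul_kronecker {A B A' B' ι κ : Type*} [Fintype A] [Fintype B]
    [Fintype A'] [Fintype B'] [Fintype ι] [Fintype κ]
    (K : ι → Matrix A' A ℂ) (L : κ → Matrix B' B ℂ) (ρ : Matrix (A × B) (A × B) ℂ)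
    (X : Matrix A' A' ℂ) (Y : Matrix B' B' ℂ) :
    (applyLocal K L ρ * (X ⊗ₖ Y)).trace =
      (ρ * (krausAdjoint K X ⊗ₖ krausAdjoint L Y)).trace := by
  have hsum : krausAdjoint K X ⊗ₖ krausAdjoint L Y =
      ∑ k, ∑ m, (K k ⊗ₖ L m)ᴴ * (X ⊗ₖ Y) * (K k ⊗ₖ L m) := by
    ext ⟨a, b⟩ ⟨a', b'⟩
    simp only [krausAdjoint, conjTranspose_kronecker, ← mul_kronecker_mul, kroneckerMap_apply,
      Matrix.sum_apply, Finset.sum_mul_sum]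
  simp only [hsum, applyLocal, Finset.sum_mul, Finset.mul_sum, Matrix.trace_sum]
  refine Finset.sum_congr rfl fun k _ => Finset.sum_congr rfl fun m _ => ?_
  rw [Matrix.mul_assoc, Matrix.mul_assoc, Matrix.trace_mul_comm]
  simp only [Matrix.mul_assoc]

/-- The Kadison–Schwarz inequality for unital completely positive maps. -/
lemma posSemidef_krausAdjoint_mul_conjTranspose_sub {A A' ι : Type*} [Fintype A] [DecidableEq A]
    [Fintype A'] [Fintype ι] {K : ι → Matrix A' A ℂ} (hK : ∑ k, (K k)ᴴ * K k = 1)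
    (X : Matrix A' A' ℂ) :
    (krausAdjoint K (X * Xᴴ) - krausAdjoint K X * (krausAdjoint K X)ᴴ).PosSemidef := by
  set Z := krausAdjoint K X with hZ
  have key : krausAdjoint K (X * Xᴴ) - Z * Zᴴ =
      ∑ k, ((K k)ᴴ * X - Z * (K k)ᴴ) * ((K k)ᴴ * X - Z * (K k)ᴴ)ᴴ := by
    have h1 : ∑ k, (K k)ᴴ * X * K k * Zᴴ = Z * Zᴴ := by
      rw [hZ, krausAdjoint, Matrix.sum_mul]
    have h2 : ∑ k, Z * ((K k)ᴴ * Xᴴ * K k) = Z * Zᴴ := by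
      rw [← Matrix.mul_sum, ← krausAdjoint_conjTranspose]; rfl
    have h3 : ∑ k, Z * ((K k)ᴴ * K k) * Zᴴ = Z * Zᴴ := by
      rw [← Matrix.sum_mul, ← Matrix.mul_sum, hK, Matrix.mul_one]
    have expand : ∀ k, ((K k)ᴴ * X - Z * (K k)ᴴ) * ((K k)ᴴ * X - Z * (K k)ᴴ)ᴴ =
        (K k)ᴴ * (X * Xᴴ) * K k - (K k)ᴴ * X * K k * Zᴴ - Z * ((K k)ᴴ * Xᴴ * K k)
          + Z * ((K k)ᴴ * K k) * Zᴴ := fun k => by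
      simp only [conjTranspose_sub, conjTranspose_mul, conjTranspose_conjTranspose,
        Matrix.sub_mul, Matrix.mul_sub, Matrix.mul_assoc]
      abel
    simp only [expand, Finset.sum_add_distrib, Finset.sum_sub_distrib, h1, h2, h3]
    rw [krausAdjoint]
    abel
  rw [key]
  exact posSemidef_sum _ fun k _ => posSemidef_self_mul_conjTranspose _

open scoped MatrixOrder in
lemma exists_conjTranspose_mul_self_eq {n : Type*} [Fintype n] [DecidableEq n]
    {P : Matrix n n ℂ} (hP : P.PosSemidef) : ∃ C : Matrix n n ℂ, P = Cᴴ * C :=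
  CStarAlgebra.nonneg_iff_eq_star_mul_self.mp hP.nonneg

lemma trace_mul_nonneg_of_posSemidef {n : Type*} [Fintype n] {P M : Matrix n n ℂ}
    (hP : P.PosSemidef) (hM : M.PosSemidef) : 0 ≤ (P * M).trace := by
  classical
  obtain ⟨C, rfl⟩ := exists_conjTranspose_mul_self_eq hM
  rw [← Matrix.mul_assoc, Matrix.trace_mul_comm, ← Matrix.mul_assoc]
  exact (hP.mul_mul_conjTranspose_same C).trace_nonneg

/-- The Cauchy–Schwarz inequality for the positive sesquilinear form `tr (P M Nᴴ)`. -/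
lemma norm_trace_mul_mul_conjTranspose_sq_le {n : Type*} [Fintype n] {P : Matrix n n ℂ}
    (hP : P.PosSemidef) (M N : Matrix n n ℂ) :
    ‖(P * (M * Nᴴ)).trace‖ ^ 2 ≤ (P * (M * Mᴴ)).trace.re * (P * (N * Nᴴ)).trace.re := by
  classical
  obtain ⟨C, rfl⟩ := exists_conjTranspose_mul_self_eq hP
  let v : Matrix n n ℂ → EuclideanSpace ℂ (n × n) := fun S => WithLp.toLp 2 fun p => (C * S) p.1 p.2
  have hv : ∀ S T : Matrix n n ℂ, (Cᴴ * C * (S * Tᴴ)).trace = inner ℂ (v T) (v S) := fun S T => by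
    have : (Cᴴ * C * (S * Tᴴ)).trace = ((C * S) * (C * T)ᴴ).trace := by
      rw [Matrix.mul_assoc, Matrix.trace_mul_comm, conjTranspose_mul]
      simp only [Matrix.mul_assoc]
    rw [this]
    simp [-conjTranspose_mul, v, PiLp.inner_apply, Matrix.trace, Matrix.mul_apply (M := C * S),
      Fintype.sum_prod_type]
  have hre : ∀ S : Matrix n n ℂ, (inner ℂ (v S) (v S) : ℂ).re = ‖v S‖ ^ 2 := fun S =>
    inner_self_eq_norm_sq (𝕜 := ℂ) (v S)
  rw [hv, hv, hv, hre, hre, ← mul_pow, mul_comm ‖v M‖]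
  exact pow_le_pow_left₀ (norm_nonneg _) (norm_inner_le_norm _ _) 2

/-- The variance-type bound on correlations. -/
lemma norm_trace_mul_kronecker_sq_le {A B : Type*} [Fintype A] [Fintype B]
    {ρ : Matrix (A × B) (A × B) ℂ} (hρ : ρ.PosSemidef) (X : Matrix A A ℂ) (Y : Matrix B B ℂ) :
    ‖(ρ * (X ⊗ₖ Yᴴ)).trace‖ ^ 2 ≤
      (ptrB ρ * (X * Xᴴ)).trace.re * (ptrA ρ * (Y * Yᴴ)).trace.re := by
  classical
  have h := norm_trace_mul_mul_conjTranspose_sq_le hρ (X ⊗ₖ (1 : Matrix B B ℂ))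
    ((1 : Matrix A A ℂ) ⊗ₖ Y)
  simpa [conjTranspose_kronecker, ← mul_kronecker_mul, trace_ptrB_mul, trace_ptrA_mul] using h

lemma bddAbove_correlations {A B : Type*} [Fintype A] [Fintype B]
    {ρ : Matrix (A × B) (A × B) ℂ} (hρ : ρ.PosSemidef) :
    BddAbove {r : ℝ | ∃ (X : Matrix A A ℂ) (Y : Matrix B B ℂ),
      ((ptrB ρ) * X).trace = 0 ∧ ((ptrA ρ) * Y).trace = 0 ∧
      ((ptrB ρ) * (X * Xᴴ)).trace = 1 ∧ ((ptrA ρ) * (Y * Yᴴ)).trace = 1 ∧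
      r = ‖(ρ * (X ⊗ₖ Yᴴ)).trace‖} := by
  refine ⟨1, ?_⟩
  rintro r ⟨X, Y, -, -, hX, hY, rfl⟩
  have h := norm_trace_mul_kronecker_sq_le hρ X Y
  rw [hX, hY] at h
  simp only [Complex.one_re, mul_one] at h
  exact (sq_le_one_iff₀ (norm_nonneg _)).mp h

lemma mu_nonneg {A B : Type*} [Fintype A] [Fintype B] (ρ : Matrix (A × B) (A × B) ℂ) :
    0 ≤ mu ρ := by
  refine Real.sSup_nonneg ?_
  rintro r ⟨X, Y, -, -, -, -, rfl⟩
  exact norm_nonneg _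

lemma trace_ptrB_mul_nonneg {A B : Type*} [Fintype A] [Fintype B]
    {ρ : Matrix (A × B) (A × B) ℂ} (hρ : ρ.PosSemidef) {M : Matrix A A ℂ} (hM : M.PosSemidef) :
    0 ≤ (ptrB ρ * M).trace := by
  classical
  rw [trace_ptrB_mul]
  exact trace_mul_nonneg_of_posSemidef hρ (hM.kronecker PosSemidef.one)

lemma trace_ptrA_mul_nonneg {A B : Type*} [Fintype A] [Fintype B]
    {ρ : Matrix (A × B) (A × B) ℂ} (hρ : ρ.PosSemidef) {M : Matrix B B ℂ} (hM : M.PosSemidef) :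
    0 ≤ (ptrA ρ * M).trace := by
  classical
  rw [trace_ptrA_mul]
  exact trace_mul_nonneg_of_posSemidef hρ (PosSemidef.one.kronecker hM)

/-- Observables of variance at most one are correlated by at most `mu ρ`. -/
lemma norm_trace_mul_kronecker_le_mu {A B : Type*} [Fintype A] [Fintype B]
    {ρ : Matrix (A × B) (A × B) ℂ} (hρ : ρ.PosSemidef) {X : Matrix A A ℂ} {Y : Matrix B B ℂ}
    (hX : (ptrB ρ * X).trace = 0) (hY : (ptrA ρ * Y).trace = 0)
    (hX1 : (ptrB ρ * (X * Xᴴ)).trace ≤ 1) (hY1 : (ptrA ρ * (Y * Yᴴ)).trace ≤ 1) :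
    ‖(ρ * (X ⊗ₖ Yᴴ)).trace‖ ≤ mu ρ := by
  have hX0 := trace_ptrB_mul_nonneg hρ (posSemidef_self_mul_conjTranspose X)
  have hY0 := trace_ptrA_mul_nonneg hρ (posSemidef_self_mul_conjTranspose Y)
  have hCS := norm_trace_mul_kronecker_sq_le hρ X Y
  obtain ⟨a, ha⟩ : ∃ a : ℝ, (ptrB ρ * (X * Xᴴ)).trace = a := ⟨_, Complex.eq_re_of_ofReal_le hX0⟩
  obtain ⟨b, hb⟩ : ∃ b : ℝ, (ptrA ρ * (Y * Yᴴ)).trace = b := ⟨_, Complex.eq_re_of_ofReal_le hY0⟩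
  rw [ha] at hX0 hX1 hCS
  rw [hb] at hY0 hY1 hCS
  simp only [Complex.ofReal_re] at hCS
  norm_cast at hX0 hX1 hY0 hY1
  rcases eq_or_ne (a * b) 0 with hab | hab
  · rw [hab] at hCS
    have h0 : ‖(ρ * (X ⊗ₖ Yᴴ)).trace‖ = 0 :=
      pow_eq_zero_iff two_ne_zero |>.mp (le_antisymm hCS (sq_nonneg _))
    rw [h0]
    exact mu_nonneg ρ
  have ha0 : 0 < a := hX0.lt_of_ne' (left_ne_zero_of_mul hab)
  have hb0 : 0 < b := hY0.lt_of_ne' (right_ne_zero_of_mul hab)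
  have hinv : ∀ c : ℝ, 0 < c → (√c : ℂ)⁻¹ * ((√c : ℂ)⁻¹ * c) = 1 := fun c hc => by
    have : (√c)⁻¹ * ((√c)⁻¹ * c) = 1 := by
      rw [← mul_assoc, ← mul_inv, Real.mul_self_sqrt hc.le, inv_mul_cancel₀ hc.ne']
    exact_mod_cast this
  have hmem : (√a)⁻¹ * ((√b)⁻¹ * ‖(ρ * (X ⊗ₖ Yᴴ)).trace‖) ≤ mu ρ := by
    refine le_csSup (bddAbove_correlations hρ)
      ⟨(√a : ℂ)⁻¹ • X, (√b : ℂ)⁻¹ • Y, ?_, ?_, ?_, ?_, ?_⟩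
    · simp [hX]
    · simp [hY]
    · simp [conjTranspose_smul, ha, hinv a ha0]
    · simp [conjTranspose_smul, hb, hinv b hb0]
    · simp [conjTranspose_smul, kronecker_smul, smul_kronecker, abs_of_nonneg (Real.sqrt_nonneg _)]
      ring
  refine le_trans ?_ hmem
  have hone : ∀ c : ℝ, 0 < c → c ≤ 1 → 1 ≤ (√c)⁻¹ := fun c hc hc1 =>
    (one_le_inv₀ (Real.sqrt_pos.mpr hc)).mpr (Real.sqrt_le_one.mpr hc1)
  exact (le_mul_of_one_le_left (norm_nonneg _) (hone b hb0 hY1)).trans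
    (le_mul_of_one_le_left (by positivity) (hone a ha0 hX1))

section LocalChannel

variable {A B A' B' ι κ : Type*} [Fintype A] [Fintype B]
  [Fintype A'] [Fintype B'] [Fintype ι] [Fintype κ]
  {K : ι → Matrix A' A ℂ} {L : κ → Matrix B' B ℂ}

lemma trace_ptrB_applyLocal_mul [DecidableEq B] (hL : ∑ m, (L m)ᴴ * L m = 1)
    (ρ : Matrix (A × B) (A × B) ℂ) (X : Matrix A' A' ℂ) :
    (ptrB (applyLocal K L ρ) * X).trace = (ptrB ρ * krausAdjoint K X).trace := by
  classical
  rw [trace_ptrB_mul, trace_ptrB_mul, trace_applyLocal_mul_kronecker, krausAdjoint_one hL]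

lemma trace_ptrA_applyLocal_mul [DecidableEq A] (hK : ∑ k, (K k)ᴴ * K k = 1)
    (ρ : Matrix (A × B) (A × B) ℂ) (Y : Matrix B' B' ℂ) :
    (ptrA (applyLocal K L ρ) * Y).trace = (ptrA ρ * krausAdjoint L Y).trace := by
  classical
  rw [trace_ptrA_mul, trace_ptrA_mul, trace_applyLocal_mul_kronecker, krausAdjoint_one hK]

lemma IsDensity.applyLocal [DecidableEq A] [DecidableEq B] {ρ : Matrix (A × B) (A × B) ℂ}
    (hρ : IsDensity ρ)
    (hK : ∑ k, (K k)ᴴ * K k = 1) (hL : ∑ m, (L m)ᴴ * L m = 1) :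
    IsDensity (applyLocal K L ρ) := by
  classical
  refine ⟨posSemidef_sum _ fun k _ => posSemidef_sum _ fun m _ =>
    hρ.1.mul_mul_conjTranspose_same _, ?_⟩
  have h := trace_applyLocal_mul_kronecker K L ρ 1 1
  rwa [krausAdjoint_one hK, krausAdjoint_one hL, one_kronecker_one, one_kronecker_one,
    Matrix.mul_one, Matrix.mul_one, hρ.2] at h

/-- Maximal correlation is monotone under local channels. -/
lemma mu_applyLocal_le [DecidableEq A] [DecidableEq B] {ρ : Matrix (A × B) (A × B) ℂ}
    (hρ : ρ.PosSemidef)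
    (hK : ∑ k, (K k)ᴴ * K k = 1) (hL : ∑ m, (L m)ᴴ * L m = 1) :
    mu (applyLocal K L ρ) ≤ mu ρ := by
  refine Real.sSup_le ?_ (mu_nonneg ρ)
  rintro r ⟨X, Y, hX, hY, hX1, hY1, rfl⟩
  rw [trace_applyLocal_mul_kronecker, krausAdjoint_conjTranspose]
  rw [trace_ptrB_applyLocal_mul hL] at hX hX1
  rw [trace_ptrA_applyLocal_mul hK] at hY hY1
  refine norm_trace_mul_kronecker_le_mu hρ hX hY ?_ ?_
  · rw [← hX1, ← sub_nonneg, ← trace_sub, ← Matrix.mul_sub]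
    exact trace_ptrB_mul_nonneg hρ (posSemidef_krausAdjoint_mul_conjTranspose_sub hK X)
  · rw [← hY1, ← sub_nonneg, ← trace_sub, ← Matrix.mul_sub]
    exact trace_ptrA_mul_nonneg hρ (posSemidef_krausAdjoint_mul_conjTranspose_sub hL Y)

end LocalChannel

lemma applyLocal_sum_smul {A B A' B' ι κ J : Type*} [Fintype A] [Fintype B] [Fintype ι]
    [Fintype κ] [Fintype J] (K : ι → Matrix A' A ℂ) (L : κ → Matrix B' B ℂ)
    (p : J → ℝ) (τ : J → Matrix (A × B) (A × B) ℂ) :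
    applyLocal K L (∑ i, p i • τ i) = ∑ i, p i • applyLocal K L (τ i) := by
  simp only [applyLocal, Matrix.mul_sum, Matrix.sum_mul, Matrix.mul_smul, Matrix.smul_mul,
    Finset.smul_sum]
  exact (Finset.sum_congr rfl fun k _ => Finset.sum_comm).trans Finset.sum_comm

/-- Maximal entanglement is monotone under local CPTP maps. -/
theorem muEnt_applyLocal_le {dA dB dA' dB' : ℕ} {ι κ : Type*} [Fintype ι] [Fintype κ]
    (ρ : Matrix (Fin dA × Fin dB) (Fin dA × Fin dB) ℂ) (hρ : IsDensity ρ)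
    (K : ι → Matrix (Fin dA') (Fin dA) ℂ) (L : κ → Matrix (Fin dB') (Fin dB) ℂ)
    (hK : ∑ k, (K k)ᴴ * K k = 1) (hL : ∑ m, (L m)ᴴ * L m = 1)
    (σ : Matrix (Fin dA' × Fin dB') (Fin dA' × Fin dB') ℂ)
    (hσ : σ = applyLocal K L ρ) :
    muEnt ρ ≥ muEnt σ := by
  subst hσ
  refine le_csInf ⟨_, 1, fun _ => 1, fun _ => ρ, by simp, by simp, fun _ => hρ, by simp, rfl⟩ ?_
  rintro r ⟨m, p, τ, hp, hp1, hτ, rfl, rfl⟩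
  refine csInf_le_of_le ⟨0, ?_⟩ ⟨m, p, fun i => applyLocal K L (τ i), hp, hp1,
    fun i => (hτ i).applyLocal hK hL, applyLocal_sum_smul K L p τ, rfl⟩ ?_
  · rintro r ⟨_, _, _, _, _, _, _, rfl⟩
    exact Real.iSup_nonneg fun _ => mu_nonneg _
  · exact Finite.ciSup_mono fun i => mu_applyLocal_le (hτ i).1 hK hL
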